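/- Let F = ℚ(q,a,c) be the field of rational functions over ℚ in the indeterminates q, a, c. For integers i ≥ j ≥ 0 define the Andrews matrix entries 𝓐_{ij}(a) := 1/((q;q)_{i−j}(aq;q)_{i+j}) and 𝓐⁻_{ij}(a) := (1 − a q^{2i}) (a;q)_{i+j} (−1)^{i−j} q^{(i−j)(i−j−1)/2} / ((1 − a)(q;q)_{i−j}), both set to 0 for i < j, and the Bressoud matrix entry 𝓑_{ij}(a,c) := (1 − a q^{2i})(a;q)_{i+j}(a/c;q)_{i−j} c^{i−j} / ((1 − a)(cq;q)_{i+j}(q;q)_{i−j}) for i ≥ j, 0 otherwise. Then for all integers i ≥ j ≥ 0 both of the following hold: (1) Σ_{k=j}^{i} a^{i−k} 𝓐⁻_{ik}(a) c^{k−j} 𝓐_{kj}(c) = 𝓑_{ij}(a,c); (2) Σ_{k=j}^{i} q^{−i²} 𝓐⁻_{ik}(a) 𝓐_{kj}(c) q^{j²} = 𝓑_{ij}(a,c). Taking c = a, both recover Andrews' matrix inversion Σ_{k=j}^{i} 𝓐⁻_{ik}(a) 𝓐_{kj}(a) = δ_{ij}. -/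

import Mathlib

open Finset

/-- The `q`-shifted factorial `(a;q)_n = ∏_{i=0}^{n-1} (1 - a q^i)`. -/
noncomputable def qPoch {F : Type*} [Field F] (q a : F) (n : ℕ) : F :=
  ∏ i ∈ Finset.range n, (1 - a * q ^ i)

/-- Andrews' matrix entry `𝓐_{ij}(a)`, zero for `i < j`. -/
noncomputable def AndrewsM {F : Type*} [Field F] (q a : F) (i j : ℕ) : F :=
  if j ≤ i then 1 / (qPoch q q (i - j) * qPoch q (a * q) (i + j)) else 0

/-- The inverse Andrews matrix entry `𝓐⁻_{ij}(a)`, zero for `i < j`. -/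
noncomputable def AndrewsInv {F : Type*} [Field F] (q a : F) (i j : ℕ) : F :=
  if j ≤ i then
    (1 - a * q ^ (2 * i)) * qPoch q a (i + j) * (-1 : F) ^ (i - j) *
      q ^ ((i - j) * ((i - j) - 1) / 2) / ((1 - a) * qPoch q q (i - j))
  else 0

/-- The Bressoud matrix entry `𝓑_{ij}(a,c)`, zero for `i < j`. -/
noncomputable def Bres {F : Type*} [Field F] (q a c : F) (i j : ℕ) : F :=
  if j ≤ i then
    (1 - a * q ^ (2 * i)) * qPoch q a (i + j) * qPoch q (a / c) (i - j) * c ^ (i - j) /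
      ((1 - a) * qPoch q (c * q) (i + j) * qPoch q q (i - j))
  else 0

/-- The field `F = ℚ(q,a,c)` of rational functions over `ℚ`. -/
noncomputable abbrev F10 : Type := FractionRing (MvPolynomial (Fin 3) ℚ)

section qPoch

variable {F : Type*} [Field F]

theorem qPoch_succ (q a : F) (n : ℕ) : qPoch q a (n + 1) = qPoch q a n * (1 - a * q ^ n) :=
  Finset.prod_range_succ _ _

theorem qPoch_add (q a : F) (m n : ℕ) :
    qPoch q a (m + n) = qPoch q a m * qPoch q (a * q ^ m) n := by
  simp only [qPoch, Finset.prod_range_add, pow_add, mul_assoc]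

theorem qPoch_succ' (q a : F) (n : ℕ) : qPoch q a (n + 1) = (1 - a) * qPoch q (a * q) n := by
  rw [add_comm, qPoch_add]
  simp [qPoch]

theorem qPoch_ne_zero {q a : F} (h : ∀ k, 1 - a * q ^ k ≠ 0) (n : ℕ) : qPoch q a n ≠ 0 :=
  Finset.prod_ne_zero_iff.mpr fun k _ => h k

theorem qPoch_one_right {q : F} {n : ℕ} (hn : n ≠ 0) : qPoch q 1 n = 0 :=
  Finset.prod_eq_zero (Finset.mem_range.mpr (Nat.pos_of_ne_zero hn)) (by simp)

theorem qPoch_div_mul_pow (q a : F) {c : F} (hc : c ≠ 0) (n : ℕ) :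
    qPoch q (a / c) n * c ^ n = ∏ i ∈ range n, (c - a * q ^ i) := by
  rw [qPoch, ← Finset.card_range n, ← Finset.prod_const, Finset.card_range,
    ← Finset.prod_mul_distrib]
  refine Finset.prod_congr rfl fun i _ => ?_
  field_simp

/-- Pascal's rule for `q`-binomial sums, in the form `[n+1, r] = [n, r-1] + q ^ r [n, r]`. -/
theorem sum_antidiagonal_succ_div_qPoch {q : F} (hq : ∀ k, 1 - q * q ^ k ≠ 0) (n : ℕ)
    (f : ℕ → ℕ → F) :
    (1 - q * q ^ n) *
        ∑ p ∈ antidiagonal (n + 1), f p.1 p.2 / (qPoch q q p.1 * qPoch q q p.2) =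
      ∑ p ∈ antidiagonal n,
        (f (p.1 + 1) p.2 + q ^ p.1 * f p.1 (p.2 + 1)) / (qPoch q q p.1 * qPoch q q p.2) := by
  have split : ∀ p ∈ antidiagonal (n + 1),
      (1 - q * q ^ n) * (f p.1 p.2 / (qPoch q q p.1 * qPoch q q p.2)) =
        (1 - q ^ p.1) * (f p.1 p.2 / (qPoch q q p.1 * qPoch q q p.2)) +
        q ^ p.1 * (1 - q ^ p.2) * (f p.1 p.2 / (qPoch q q p.1 * qPoch q q p.2)) := by
    intro p hp
    rw [← pow_succ', ← mem_antidiagonal.mp hp]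
    ring
  rw [Finset.mul_sum, Finset.sum_congr rfl split, Finset.sum_add_distrib,
    Finset.Nat.sum_antidiagonal_succ, Finset.Nat.sum_antidiagonal_succ']
  simp only [pow_zero, sub_self, zero_mul, mul_zero, zero_add,
    ← Finset.sum_add_distrib]
  refine Finset.sum_congr rfl fun p _ => ?_
  have h1 := qPoch_ne_zero hq p.1
  have h2 := qPoch_ne_zero hq p.2
  have h3 := hq p.1
  have h4 := hq p.2
  rw [qPoch_succ, qPoch_succ, pow_succ', pow_succ']
  field_simp

/-- Pascal's rule for `q`-binomial sums, in the form `[n+1, r] = q ^ (n+1-r) [n, r-1] + [n, r]`. -/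
theorem sum_antidiagonal_succ_div_qPoch' {q : F} (hq : ∀ k, 1 - q * q ^ k ≠ 0) (n : ℕ)
    (f : ℕ → ℕ → F) :
    (1 - q * q ^ n) *
        ∑ p ∈ antidiagonal (n + 1), f p.1 p.2 / (qPoch q q p.1 * qPoch q q p.2) =
      ∑ p ∈ antidiagonal n,
        (q ^ p.2 * f (p.1 + 1) p.2 + f p.1 (p.2 + 1)) / (qPoch q q p.1 * qPoch q q p.2) := by
  have h := sum_antidiagonal_succ_div_qPoch hq n fun r m => f m r
  rw [← Finset.Nat.sum_antidiagonal_swap, ← Finset.Nat.sum_antidiagonal_swap (n := n)] at h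
  simpa only [Prod.fst_swap, Prod.snd_swap, add_comm, mul_comm] using h

theorem prod_range_mul_sub_mul (q b C : F) (n : ℕ) :
    ∏ i ∈ range n, (C * q * q ^ i - b * q) = q ^ n * ∏ i ∈ range n, (C * q ^ i - b) := by
  rw [← Finset.card_range n, ← Finset.prod_const, Finset.card_range, ← Finset.prod_mul_distrib]
  exact Finset.prod_congr rfl fun i _ => by ring

/-- The first `q`-Chu–Vandermonde summation, in polynomial form. -/
theorem qChuVandermonde_pow {q : F} (hq : ∀ k, 1 - q * q ^ k ≠ 0) (n : ℕ) (b C : F) :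
    ∑ p ∈ antidiagonal n,
        qPoch q b p.1 * qPoch q (C * q ^ p.1) p.2 * (-b) ^ p.2 * C ^ p.1 * q ^ p.1.choose 2 /
          (qPoch q q p.1 * qPoch q q p.2) =
      (∏ i ∈ range n, (C * q ^ i - b)) / qPoch q q n := by
  induction n generalizing b C with
  | zero => simp [qPoch]
  | succ n ih =>
    apply mul_left_cancel₀ (hq n)
    rw [sum_antidiagonal_succ_div_qPoch' hq n fun r m =>
      qPoch q b r * qPoch q (C * q ^ r) m * (-b) ^ m * C ^ r * q ^ r.choose 2]
    trans (1 - b) * C * ((∏ i ∈ range n, (C * q * q ^ i - b * q)) / qPoch q q n) -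
      b * (1 - C * q ^ n) * ((∏ i ∈ range n, (C * q ^ i - b)) / qPoch q q n)
    · rw [← ih, ← ih, Finset.mul_sum, Finset.mul_sum, ← Finset.sum_sub_distrib]
      refine Finset.sum_congr rfl fun p hp => ?_
      rw [← mem_antidiagonal.mp hp, qPoch_succ', qPoch_succ, Nat.choose_succ_succ' p.1 1,
        Nat.choose_one_right, pow_succ' q p.1, ← mul_assoc C q]
      ring
    · have h1 := qPoch_ne_zero hq n
      have h2 := hq n
      rw [prod_range_mul_sub_mul, Finset.prod_range_succ, qPoch_succ]
      generalize 1 - q * q ^ n = d at h2 ⊢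
      field_simp
      ring

/-- The second `q`-Chu–Vandermonde summation, in polynomial form. -/
theorem qChuVandermonde {q : F} (hq : ∀ k, 1 - q * q ^ k ≠ 0) (n : ℕ) (b C : F) :
    ∑ p ∈ antidiagonal n,
        qPoch q b p.1 * qPoch q (C * q ^ p.1) p.2 * (-1) ^ p.2 * q ^ p.2.choose 2 /
          (qPoch q q p.1 * qPoch q q p.2) =
      q ^ n.choose 2 * (∏ i ∈ range n, (C * q ^ i - b)) / qPoch q q n := by
  induction n generalizing b C with
  | zero => simp [qPoch]
  | succ n ih =>
    apply mul_left_cancel₀ (hq n)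
    rw [sum_antidiagonal_succ_div_qPoch hq n fun r m =>
      qPoch q b r * qPoch q (C * q ^ r) m * (-1) ^ m * q ^ m.choose 2]
    trans (1 - b) *
        (q ^ n.choose 2 * (∏ i ∈ range n, (C * q * q ^ i - b * q)) / qPoch q q n) -
      q ^ n * (1 - C * q ^ n) *
        (q ^ n.choose 2 * (∏ i ∈ range n, (C * q ^ i - b)) / qPoch q q n)
    · rw [← ih, ← ih, Finset.mul_sum, Finset.mul_sum, ← Finset.sum_sub_distrib]
      refine Finset.sum_congr rfl fun p hp => ?_
      rw [← mem_antidiagonal.mp hp, qPoch_succ', qPoch_succ, Nat.choose_succ_succ' p.2 1,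
        Nat.choose_one_right, pow_succ' q p.1, ← mul_assoc C q]
      ring
    · have h1 := qPoch_ne_zero hq n
      have h2 := hq n
      rw [prod_range_mul_sub_mul, Finset.prod_range_succ, qPoch_succ,
        Nat.choose_succ_succ' n 1, Nat.choose_one_right]
      generalize 1 - q * q ^ n = d at h2 ⊢
      field_simp
      ring

theorem Nat.add_choose_two' (r m : ℕ) :
    (r + m).choose 2 = r.choose 2 + m.choose 2 + r * m := by
  induction m with
  | zero => simp
  | succ m ih =>
    rw [← add_assoc, Nat.choose_succ_succ' _ 1, Nat.choose_succ_succ' m 1, ih]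
    simp only [Nat.choose_one_right]
    ring

theorem Nat.sq_eq_two_mul_choose_two_add (m : ℕ) : m ^ 2 = 2 * m.choose 2 + m := by
  rw [Nat.choose_two_right, Nat.mul_div_cancel' (Nat.even_mul_pred_self m).two_dvd]
  cases m <;> simp; ring

theorem prod_range_mul_pow_sub_mul_pow (q a c s : F) (n : ℕ) :
    ∏ i ∈ range n, (c * s * q * q ^ i - a * s * q ^ n) =
      (s * q) ^ n * q ^ n.choose 2 * ∏ i ∈ range n, (c - a * q ^ i) := by
  induction n generalizing a with
  | zero => simp
  | succ n ih =>
    have h : ∏ i ∈ range n, (c * s * q * q ^ i - a * s * q ^ (n + 1)) =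
        (s * q) ^ n * q ^ n.choose 2 * ∏ i ∈ range n, (c - a * q ^ (i + 1)) := by
      simpa only [pow_succ', mul_assoc, mul_left_comm q] using ih (a * q)
    rw [Finset.prod_range_succ, Finset.prod_range_succ', Nat.choose_succ_succ' n 1,
      Nat.choose_one_right, h]
    ring

theorem sum_Icc_add_eq_sum_antidiagonal {M : Type*} [AddCommMonoid M] (f : ℕ → M) (j n : ℕ) :
    ∑ k ∈ Icc j (j + n), f k = ∑ p ∈ antidiagonal n, f (j + p.1) := by
  rw [Finset.Nat.sum_antidiagonal_eq_sum_range_succ_mk, ← Finset.Ico_add_one_right_eq_Icc,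
    Finset.sum_Ico_eq_sum_range]
  congr 2
  omega

theorem AndrewsInv_mul_AndrewsM {q a c : F} (hc : ∀ k, 1 - c * q * q ^ k ≠ 0) (j r m : ℕ) :
    AndrewsInv q a (j + (r + m)) (j + r) * AndrewsM q c (j + r) j =
      (1 - a * q ^ (2 * (j + (r + m)))) * qPoch q a (j + (r + m) + j) /
        ((1 - a) * qPoch q (c * q) (j + (r + m) + j)) *
      (qPoch q (a * q ^ (2 * j) * q ^ (r + m)) r * qPoch q (c * q ^ (2 * j) * q * q ^ r) m *
        (-1) ^ m * q ^ m.choose 2 / (qPoch q q r * qPoch q q m)) := by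
  have e1 : j + (r + m) + (j + r) = (j + (r + m) + j) + r := by ring
  have e2 : j + (r + m) + j = (j + r + j) + m := by ring
  have e3 : j + (r + m) - (j + r) = m := by omega
  have e4 : a * q ^ (j + (r + m) + j) = a * q ^ (2 * j) * q ^ (r + m) := by ring
  have e5 : c * q * q ^ (j + r + j) = c * q ^ (2 * j) * q * q ^ r := by ring
  have h1 := qPoch_ne_zero hc (j + r + j)
  have h2 : qPoch q (c * q ^ (2 * j) * q * q ^ r) m ≠ 0 := by
    refine qPoch_ne_zero (fun k => ?_) m
    convert hc (2 * j + r + k) using 2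
    ring
  rw [AndrewsInv, AndrewsM, if_pos (by omega), if_pos (by omega), e1, qPoch_add q a _ r, e4,
    e3, Nat.add_sub_cancel_left, ← Nat.choose_two_right, congrArg (qPoch q (c * q)) e2,
    qPoch_add q (c * q) _ m, e5]
  generalize qPoch q (c * q ^ (2 * j) * q * q ^ r) m = V at h2 ⊢
  field_simp

theorem Bres_add_eq {q a c : F} (hc : c ≠ 0) (j n : ℕ) :
    Bres q a c (j + n) j =
      (1 - a * q ^ (2 * (j + n))) * qPoch q a (j + n + j) /
        ((1 - a) * qPoch q (c * q) (j + n + j)) *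
      ((∏ i ∈ range n, (c - a * q ^ i)) / qPoch q q n) := by
  rw [Bres, if_pos (by omega), Nat.add_sub_cancel_left, ← qPoch_div_mul_pow q a hc]
  simp only [div_eq_mul_inv, mul_inv]
  ring

theorem sum_pow_mul_AndrewsInv_mul_AndrewsM {q a c : F} (hq0 : q ≠ 0) (hc0 : c ≠ 0)
    (hq : ∀ k, 1 - q * q ^ k ≠ 0) (hc : ∀ k, 1 - c * q * q ^ k ≠ 0) (j n : ℕ) :
    ∑ k ∈ Icc j (j + n),
        a ^ (j + n - k) * AndrewsInv q a (j + n) k * c ^ (k - j) * AndrewsM q c k j =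
      Bres q a c (j + n) j := by
  have hs : (q ^ (2 * j) * q) ^ n * q ^ n.choose 2 ≠ 0 := by positivity
  apply mul_left_cancel₀ hs
  have key := qChuVandermonde_pow hq n (a * q ^ (2 * j) * q ^ n) (c * q ^ (2 * j) * q)
  rw [prod_range_mul_pow_sub_mul_pow] at key
  rw [Bres_add_eq hc0, mul_left_comm, ← mul_div_assoc, ← key, Finset.mul_sum,
    sum_Icc_add_eq_sum_antidiagonal, Finset.mul_sum]
  refine Finset.sum_congr rfl fun p hp => ?_
  obtain ⟨r, m⟩ := p
  obtain rfl := mem_antidiagonal.mp hp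
  have h := AndrewsInv_mul_AndrewsM (a := a) hc j r m
  dsimp only at h ⊢
  rw [show j + (r + m) - (j + r) = m by omega, Nat.add_sub_cancel_left,
    mul_right_comm (a ^ m), mul_assoc (a ^ m * c ^ r), h, Nat.add_choose_two']
  have hm : q ^ (m * m) = q ^ (2 * m.choose 2 + m) := by
    rw [← Nat.sq_eq_two_mul_choose_two_add, sq]
  generalize (1 - a * q ^ (2 * (j + (r + m)))) * qPoch q a (j + (r + m) + j) /
        ((1 - a) * qPoch q (c * q) (j + (r + m) + j)) = K
  simp only [div_eq_mul_inv]
  generalize (qPoch q q r * qPoch q q m)⁻¹ = D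
  generalize qPoch q (a * q ^ (2 * j) * q ^ (r + m)) r = U
  generalize qPoch q (c * q ^ (2 * j) * q * q ^ r) m = V
  trans K * D * U * V * (-1) ^ m * a ^ m * c ^ r * q ^ (2 * j * (r + m) + r + r.choose 2 + r * m) *
    q ^ (2 * m.choose 2 + m)
  · ring
  · rw [← hm]
    rw [neg_pow]
    ring

theorem sum_AndrewsInv_mul_AndrewsM {q a c : F} (hc0 : c ≠ 0)
    (hq : ∀ k, 1 - q * q ^ k ≠ 0) (hc : ∀ k, 1 - c * q * q ^ k ≠ 0) (j n : ℕ) :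
    ∑ k ∈ Icc j (j + n), AndrewsInv q a (j + n) k * AndrewsM q c k j =
      q ^ (n ^ 2 + 2 * j * n) * Bres q a c (j + n) j := by
  have key := qChuVandermonde hq n (a * q ^ (2 * j) * q ^ n) (c * q ^ (2 * j) * q)
  rw [prod_range_mul_pow_sub_mul_pow] at key
  have e : q ^ (n ^ 2 + 2 * j * n) = q ^ n.choose 2 * ((q ^ (2 * j) * q) ^ n * q ^ n.choose 2) := by
    rw [Nat.sq_eq_two_mul_choose_two_add]
    ring
  rw [Bres_add_eq hc0, mul_left_comm, ← mul_div_assoc, e, mul_assoc (q ^ n.choose 2), ← key,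
    Finset.mul_sum, sum_Icc_add_eq_sum_antidiagonal]
  refine Finset.sum_congr rfl fun p hp => ?_
  rw [← mem_antidiagonal.mp hp]
  exact AndrewsInv_mul_AndrewsM hc j p.1 p.2

theorem Bres_self {q a : F} (ha0 : a ≠ 0) (ha : ∀ k, 1 - a * q ^ k ≠ 0) {i j : ℕ}
    (hij : j ≤ i) : Bres q a a i j = if i = j then 1 else 0 := by
  rw [Bres, if_pos hij, div_self ha0]
  split_ifs with h
  · subst h
    have h1 := qPoch_ne_zero ha (i + i)
    have h2 : (1 - a) * qPoch q (a * q) (i + i) = qPoch q a (i + i) * (1 - a * q ^ (2 * i)) := by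
      rw [← qPoch_succ', qPoch_succ, two_mul]
    have h3 := ha (2 * i)
    rw [h2]
    simp only [Nat.sub_self, qPoch, Finset.range_zero, Finset.prod_empty, pow_zero, mul_one]
    rw [mul_comm]
    exact div_self (mul_ne_zero h1 h3)
  · rw [qPoch_one_right (by omega)]
    simp

end qPoch

theorem one_sub_algebraMap_X_mul_ne_zero (s : Fin 3) (p : MvPolynomial (Fin 3) ℚ) :
    1 - algebraMap (MvPolynomial (Fin 3) ℚ) F10 (MvPolynomial.X s) *
      algebraMap (MvPolynomial (Fin 3) ℚ) F10 p ≠ 0 := by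
  intro h
  rw [← map_mul, ← map_one (algebraMap (MvPolynomial (Fin 3) ℚ) F10), ← map_sub] at h
  have h0 := (map_eq_zero_iff _ (IsFractionRing.injective (MvPolynomial (Fin 3) ℚ) F10)).mp h
  simpa using congrArg (MvPolynomial.eval 0) h0

theorem algebraMap_X_ne_zero (s : Fin 3) :
    algebraMap (MvPolynomial (Fin 3) ℚ) F10 (MvPolynomial.X s) ≠ 0 :=
  (map_ne_zero_iff _ (IsFractionRing.injective (MvPolynomial (Fin 3) ℚ) F10)).mpr
    (MvPolynomial.X_ne_zero s)

/-- Corollary D.4: the two summation formulas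
`Σ_k a^{i-k} 𝓐⁻_{ik}(a) c^{k-j} 𝓐_{kj}(c) = 𝓑_{ij}(a,c)` and
`Σ_k q^{-i²} 𝓐⁻_{ik}(a) 𝓐_{kj}(c) q^{j²} = 𝓑_{ij}(a,c)`, and (with `c = a`)
Andrews' matrix inversion `Σ_k 𝓐⁻_{ik}(a) 𝓐_{kj}(a) = δ_{ij}`. -/
theorem statement10
    (q a c : F10)
    (hq : q = algebraMap (MvPolynomial (Fin 3) ℚ) F10 (MvPolynomial.X 0))
    (ha : a = algebraMap (MvPolynomial (Fin 3) ℚ) F10 (MvPolynomial.X 1))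
    (hc : c = algebraMap (MvPolynomial (Fin 3) ℚ) F10 (MvPolynomial.X 2)) :
    ∀ i j : ℕ, j ≤ i →
      (∑ k ∈ Finset.Icc j i,
          a ^ (i - k) * AndrewsInv q a i k * c ^ (k - j) * AndrewsM q c k j =
        Bres q a c i j) ∧
      (∑ k ∈ Finset.Icc j i,
          q ^ (-((i : ℤ) ^ 2)) * AndrewsInv q a i k * AndrewsM q c k j * q ^ ((j : ℤ) ^ 2) =
        Bres q a c i j) ∧
      (∑ k ∈ Finset.Icc j i, AndrewsInv q a i k * AndrewsM q a k j =
        if i = j then 1 else 0) := by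
  have hq0 : q ≠ 0 := hq ▸ algebraMap_X_ne_zero 0
  have ha0 : a ≠ 0 := ha ▸ algebraMap_X_ne_zero 1
  have hc0 : c ≠ 0 := hc ▸ algebraMap_X_ne_zero 2
  have hqk (k : ℕ) : 1 - q * q ^ k ≠ 0 := by
    simpa [hq] using one_sub_algebraMap_X_mul_ne_zero 0 (MvPolynomial.X 0 ^ k)
  have hak (k : ℕ) : 1 - a * q ^ k ≠ 0 := by
    simpa [hq, ha] using one_sub_algebraMap_X_mul_ne_zero 1 (MvPolynomial.X 0 ^ k)
  have haqk (k : ℕ) : 1 - a * q * q ^ k ≠ 0 := by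
    simpa only [pow_succ', mul_assoc] using hak (k + 1)
  have hcqk (k : ℕ) : 1 - c * q * q ^ k ≠ 0 := by
    simpa [hq, hc, pow_succ', mul_assoc] using
      one_sub_algebraMap_X_mul_ne_zero 2 (MvPolynomial.X 0 ^ (k + 1))
  intro i j hij
  obtain ⟨n, rfl⟩ := Nat.exists_eq_add_of_le hij
  refine ⟨sum_pow_mul_AndrewsInv_mul_AndrewsM hq0 hc0 hqk hcqk j n, ?_, ?_⟩
  · have e : q ^ (-((j + n : ℕ) : ℤ) ^ 2) * q ^ ((j : ℤ) ^ 2) * q ^ (n ^ 2 + 2 * j * n) = 1 := by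
      rw [← zpow_natCast, ← zpow_add₀ hq0, ← zpow_add₀ hq0, ← zpow_zero q]
      congr 1
      push_cast
      ring
    rw [← one_mul (Bres q a c (j + n) j), ← e, mul_assoc,
      ← sum_AndrewsInv_mul_AndrewsM hc0 hqk hcqk, Finset.mul_sum]
    exact Finset.sum_congr rfl fun k _ => by ring
  · rw [sum_AndrewsInv_mul_AndrewsM ha0 hqk haqk, Bres_self ha0 hak hij]
    split_ifs with h
    · obtain rfl : n = 0 := by omega
      simp
    · simp
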